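/- Let m ≥ 2 and d = 2m + 1. Let T ∈ S^d ℂ³ be a nonzero ternary form of degree d, and let A ⊆ ℙ²(ℂ) be a non-redundant finite set computing T, with r = ℓ(A). If k_m(A) = min{ binom(m+2,2), r } and h_A(m+1) = r ≤ binom(m+2,2) + ⌈m/2⌉, then A computes the rank of T, i.e. the rank of T equals r. -/

import Mathlib

open MvPolynomial

noncomputable section

/-- Projective n-space over ℂ, viewed as classes of linear forms (vectors in ℂ^{n+1}). -/
abbrev Proj (n : ℕ) := Projectivization ℂ (Fin (n + 1) → ℂ)

instance (n : ℕ) : DecidableEq (Proj n) := Classical.decEq _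

/-- The linear form with coefficient vector `v`. -/
def linForm (n : ℕ) (v : Fin (n + 1) → ℂ) : MvPolynomial (Fin (n + 1)) ℂ :=
  ∑ i, MvPolynomial.C (v i) * MvPolynomial.X i

/-- The `d`-th Veronese image of a projective point: the `d`-th power of (a representative of)
the corresponding linear form. -/
def vero (n d : ℕ) (P : Proj n) : MvPolynomial (Fin (n + 1)) ℂ :=
  linForm n P.rep ^ d

/-- `A` computes `T` : the class of `T` lies in the projective linear span of `v_d(A)`,
equivalently `T` lies in the linear span of the `d`-th powers of the points of `A`. -/
def Computes (n d : ℕ) (A : Finset (Proj n)) (T : MvPolynomial (Fin (n + 1)) ℂ) : Prop :=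
  T ∈ Submodule.span ℂ (vero n d '' (A : Set (Proj n)))

/-- `A` is a non-redundant set computing `T`. -/
def NRComputes (n d : ℕ) (A : Finset (Proj n)) (T : MvPolynomial (Fin (n + 1)) ℂ) : Prop :=
  Computes n d A T ∧ ∀ A' ⊂ A, ¬ Computes n d A' T

/-- The (Waring) rank of `T` : minimal cardinality of a finite set computing `T`. -/
def waringRank (n d : ℕ) (T : MvPolynomial (Fin (n + 1)) ℂ) : ℕ :=
  sInf {r | ∃ A : Finset (Proj n), A.card = r ∧ Computes n d A T}

/-- `T` is identifiable: there is exactly one finite set computing `T` whose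
cardinality equals the rank of `T`. -/
def Identifiable (n d : ℕ) (T : MvPolynomial (Fin (n + 1)) ℂ) : Prop :=
  ∃! A : Finset (Proj n), A.card = waringRank n d T ∧ Computes n d A T

/-- The evaluation map of degree `j` on the chosen homogeneous coordinates of `Z`. -/
def evalMap (n j : ℕ) (Z : Finset (Proj n)) :
    MvPolynomial.homogeneousSubmodule (Fin (n + 1)) ℂ j →ₗ[ℂ] (Z → ℂ) where
  toFun F := fun P => MvPolynomial.eval (P.1).rep F.1
  map_add' F G := by funext P; simp
  map_smul' c F := by funext P; simp

/-- The Hilbert function of the finite set `Z` (at a natural number `j`). -/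
def hilbN (n : ℕ) (Z : Finset (Proj n)) (j : ℕ) : ℕ :=
  Module.finrank ℂ (LinearMap.range (evalMap n j Z))

/-- The Hilbert function of the finite set `Z` (zero in negative degrees). -/
def hilb (n : ℕ) (Z : Finset (Proj n)) (j : ℤ) : ℕ :=
  if j < 0 then 0 else hilbN n Z j.toNat

/-- The first difference of the Hilbert function. -/
def Dhilb (n : ℕ) (Z : Finset (Proj n)) (j : ℤ) : ℤ :=
  (hilb n Z j : ℤ) - (hilb n Z (j - 1) : ℤ)

/-- The `d`-th Kruskal rank of `A` : the largest `k` such that every subset of `A`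
with at most `k` elements has linearly independent image under `v_d`. -/
def kruskalRank (n d : ℕ) (A : Finset (Proj n)) : ℕ :=
  sSup {k | k ≤ A.card ∧
    ∀ A' ⊆ A, A'.card ≤ k → LinearIndependent ℂ (fun P : A' => vero n d P.1)}

/-- The Cayley–Bacharach property in degree `d` for the finite set `Z`. -/
def CB (n d : ℕ) (Z : Finset (Proj n)) : Prop :=
  ∀ P ∈ Z, ∀ F : MvPolynomial (Fin (n + 1)) ℂ, F.IsHomogeneous d →
    (∀ Q ∈ Z, Q ≠ P → MvPolynomial.eval Q.rep F = 0) → MvPolynomial.eval P.rep F = 0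

end


open MvPolynomial

/-- ternary polynomials -/
abbrev TP := MvPolynomial (Fin 3) ℂ

theorem hc_mul {F : TP} {k : ℕ} (hF : F.IsHomogeneous k) (n : ℕ) (w : TP) :
    homogeneousComponent (k + n) (F * w) = F * homogeneousComponent n w := by
  have h := sum_homogeneousComponent w
  conv_lhs => rw [← h, Finset.mul_sum, map_sum]
  have h1 : ∀ i, homogeneousComponent (k + n) (F * homogeneousComponent i w) =
      if n = i then F * homogeneousComponent i w else 0 := by
    intro i
    rw [homogeneousComponent_of_mem (hF.mul (homogeneousComponent_isHomogeneous i w))]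
    simp
  simp only [h1, Finset.sum_ite_eq, Finset.mem_range]
  split_ifs with h2
  · rfl
  · rw [homogeneousComponent_eq_zero _ _ (by omega), mul_zero]

theorem tau_coeff (A : TP) (j : ℕ) :
    (MvPolynomial.aeval (fun i => Polynomial.C (X i : TP) * Polynomial.X) A : Polynomial TP).coeff j
      = homogeneousComponent j A := by
  induction A using MvPolynomial.induction_on' with
  | add p q hp hq => simp [hp, hq]
  | monomial s c =>
    rw [MvPolynomial.aeval_monomial]
    have h1 : (s.prod fun i k => (Polynomial.C (X i : TP) * Polynomial.X) ^ k)
        = Polynomial.C (monomial s (1:ℂ)) * Polynomial.X ^ s.degree := by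
      rw [MvPolynomial.monomial_eq, C_1, one_mul, Finsupp.prod, Finsupp.prod, map_prod,
        Finsupp.degree_apply, ← Finset.prod_pow_eq_pow_sum, ← Finset.prod_mul_distrib]
      simp [mul_pow]
    rw [h1, show (algebraMap ℂ (Polynomial TP)) c = Polynomial.C (C c : TP) from rfl,
      ← mul_assoc, ← Polynomial.C_mul, C_mul_monomial, mul_one, Polynomial.coeff_C_mul_X_pow]
    split_ifs with h
    · rw [homogeneousComponent_of_mem (isHomogeneous_monomial c h.symm), if_pos rfl]
    · rw [homogeneousComponent_of_mem (isHomogeneous_monomial c rfl), if_neg h]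

theorem homog_of_mul {A B : TP} {n : ℕ} (h : (A * B).IsHomogeneous n) (h0 : A * B ≠ 0) :
    ∃ i j, A.IsHomogeneous i ∧ B.IsHomogeneous j ∧ i + j = n := by
  set τ : TP →ₐ[ℂ] Polynomial TP :=
    MvPolynomial.aeval (fun i => Polynomial.C (X i : TP) * Polynomial.X) with hτ
  have hc : ∀ (A : TP) (j : ℕ), (τ A).coeff j = homogeneousComponent j A := tau_coeff
  have hne : ∀ A : TP, A ≠ 0 → τ A ≠ 0 := by
    intro A hA h
    apply hA
    rw [← sum_homogeneousComponent A]
    apply Finset.sum_eq_zero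
    intro i _
    rw [← hc, h, Polynomial.coeff_zero]
  have hA := left_ne_zero_of_mul h0
  have hB := right_ne_zero_of_mul h0
  have hAB : τ A * τ B = Polynomial.monomial n (A * B) := by
    rw [← map_mul]
    ext1 j
    rw [hc, Polynomial.coeff_monomial, homogeneousComponent_of_mem h]
    simp [eq_comm]
  have d1 := Polynomial.natDegree_mul (hne A hA) (hne B hB)
  have d2 := Polynomial.natTrailingDegree_mul (hne A hA) (hne B hB)
  rw [hAB, Polynomial.natDegree_monomial_eq _ h0] at d1
  rw [hAB, Polynomial.natTrailingDegree_monomial h0] at d2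
  have e1 := Polynomial.natTrailingDegree_le_natDegree (τ A)
  have e2 := Polynomial.natTrailingDegree_le_natDegree (τ B)
  have key : ∀ A : TP, (τ A).natTrailingDegree = (τ A).natDegree →
      A.IsHomogeneous (τ A).natDegree := by
    intro A hA
    have : A = homogeneousComponent (τ A).natDegree A := by
      conv_lhs => rw [← sum_homogeneousComponent A]
      by_cases hm : (τ A).natDegree ∈ Finset.range (A.totalDegree + 1)
      · refine Finset.sum_eq_single_of_mem _ hm ?_
        intro b _ hb
        rw [← hc]
        rcases lt_or_gt_of_ne hb with hb | hb
        · exact Polynomial.coeff_eq_zero_of_lt_natTrailingDegree (by omega)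
        · exact Polynomial.coeff_eq_zero_of_natDegree_lt hb
      · rw [homogeneousComponent_eq_zero _ _ (by rw [Finset.mem_range] at hm; omega)]
        apply Finset.sum_eq_zero
        intro b hb'
        have hb : b ≠ (τ A).natDegree := by rintro rfl; exact hm hb'
        rw [← hc]
        rcases lt_or_gt_of_ne hb with hb | hb
        · exact Polynomial.coeff_eq_zero_of_lt_natTrailingDegree (by omega)
        · exact Polynomial.coeff_eq_zero_of_natDegree_lt hb
    rw [this]
    have h2 := homogeneousComponent_isHomogeneous (τ A).natDegree A
    rwa [← this] at h2 ⊢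
  exact ⟨_, _, key A (by omega), key B (by omega), d1.symm⟩

theorem finrank_homog (n : ℕ) :
    Module.finrank ℂ (homogeneousSubmodule (Fin 3) ℂ n) = (n + 2).choose 2 := by
  classical
  have e : (homogeneousSubmodule (Fin 3) ℂ n) ≃ₗ[ℂ] ({d : Fin 3 →₀ ℕ | d.degree = n} →₀ ℂ) := by
    rw [homogeneousSubmodule_eq_finsupp_supported]
    exact AddMonoidAlgebra.supportedEquivFinsupp _
  have hs : {d : Fin 3 →₀ ℕ | d.degree = n} = ↑(Finset.univ.finsuppAntidiag n : Finset (Fin 3 →₀ ℕ)) := by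
    ext d
    simp [Finset.mem_finsuppAntidiag, Finsupp.degree_eq_sum]
  rw [e.finrank_eq, hs]
  rw [Module.finrank_finsupp_self]
  rw [show Fintype.card ↑(↑(Finset.univ.finsuppAntidiag n : Finset (Fin 3 →₀ ℕ)) : Set (Fin 3 →₀ ℕ))
    = (Finset.univ.finsuppAntidiag n : Finset (Fin 3 →₀ ℕ)).card by simp, Finset.card_finsuppAntidiag_nat_eq_choose]
  simp only [Finset.card_univ, Fintype.card_fin]
  rw [show 3 + n - 1 = n + 2 by omega, ← Nat.choose_symm_of_eq_add (show n + 2 = 2 + n by omega)]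

instance fd_homog (n : ℕ) : FiniteDimensional ℂ (homogeneousSubmodule (Fin 3) ℂ n) :=
  Module.finite_of_finrank_pos (by rw [finrank_homog]; exact Nat.choose_pos (by omega))

theorem relation_iff (d : ℕ) (Z : Finset (Proj 2)) (c : Proj 2 → ℂ) :
    (∑ P ∈ Z, c P • vero 2 d P = 0) ↔
      ∀ Φ : TP, Φ.IsHomogeneous d → ∑ P ∈ Z, c P * MvPolynomial.eval P.rep Φ = 0 := by
  have hco : ∀ (P : Proj 2) (s : Fin 3 →₀ ℕ), coeff s (vero 2 d P) =
      if s.sum (fun _ m ↦ m) = d then s.multinomial * s.prod (fun r m ↦ P.rep r ^ m) else 0 := by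
    intro P s
    rw [← coeff_linearCombination_X_pow_of_fintype, vero, linForm]
    simp [smul_eq_C_mul]
  constructor
  · intro h Φ hΦ
    have : ∀ P : Proj 2, MvPolynomial.eval P.rep Φ =
        ∑ s ∈ Φ.support, coeff s Φ * (s.multinomial : ℂ)⁻¹ * coeff s (vero 2 d P) := by
      intro P
      rw [MvPolynomial.eval_eq]
      apply Finset.sum_congr rfl
      intro s hs
      have hd : s.sum (fun _ m ↦ m) = d := by
        have := hΦ (mem_support_iff.mp hs)
        rw [← this, Pi.one_def, ← Finsupp.degree_eq_weight_one]; rfl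
      have hm : (s.multinomial : ℂ) ≠ 0 := by
        exact_mod_cast (Nat.multinomial_pos _ _).ne'
      rw [hco, if_pos hd, Finsupp.prod]
      field_simp
    simp only [this, Finset.mul_sum]
    rw [Finset.sum_comm]
    apply Finset.sum_eq_zero
    intro s _
    have h2 := congrArg (coeff s) h
    rw [coeff_sum] at h2
    simp only [coeff_smul, smul_eq_mul, coeff_zero] at h2
    calc _ = coeff s Φ * (s.multinomial : ℂ)⁻¹ * ∑ P ∈ Z, c P * coeff s (vero 2 d P) := by
          rw [Finset.mul_sum]; apply Finset.sum_congr rfl; intros; ring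
      _ = 0 := by rw [h2, mul_zero]
  · intro h
    ext s
    rw [coeff_sum]
    simp only [coeff_smul, smul_eq_mul, coeff_zero, hco]
    split_ifs with hd
    · have := h (monomial s 1) (isHomogeneous_monomial _ hd)
      simp only [eval_monomial, one_mul] at this
      calc _ = (s.multinomial : ℂ) * ∑ P ∈ Z, c P * s.prod (fun r m ↦ P.rep r ^ m) := by
            rw [Finset.mul_sum]; apply Finset.sum_congr rfl; intros; ring
        _ = 0 := by rw [this, mul_zero]
    · simp

/-- homogenisation in the first two variables -/
noncomputable def homg (n : ℕ) (p : Polynomial ℂ) : TP :=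
  ∑ i ∈ Finset.range (n + 1), C (p.coeff i) * (X 0 ^ i * X 1 ^ (n - i))

/-- restriction to the line `z = a x + b y`, dehomogenised with `y = 1` -/
noncomputable def theta (a b : ℂ) : TP →ₐ[ℂ] Polynomial ℂ :=
  MvPolynomial.aeval ![Polynomial.X, 1, Polynomial.C a * Polynomial.X + Polynomial.C b]

theorem homg_isHom (n : ℕ) (p : Polynomial ℂ) : (homg n p).IsHomogeneous n := by
  apply IsHomogeneous.sum
  intro i hi
  apply IsHomogeneous.C_mul
  have h := (isHomogeneous_X_pow (R := ℂ) (0 : Fin 3) i).mul (isHomogeneous_X_pow (1 : Fin 3) (n - i))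
  rwa [show i + (n - i) = n by have := Finset.mem_range.mp hi; omega] at h

theorem theta_homg (a b : ℂ) (n : ℕ) (p : Polynomial ℂ) (hp : p.natDegree ≤ n) :
    theta a b (homg n p) = p := by
  rw [homg, map_sum]
  conv_rhs => rw [p.as_sum_range' (n + 1) (by omega)]
  apply Finset.sum_congr rfl
  intro i _
  simp [theta, MvPolynomial.algHom_C, ← Polynomial.C_mul_X_pow_eq_monomial]

theorem homg_add (n : ℕ) (p q : Polynomial ℂ) : homg n (p + q) = homg n p + homg n q := by
  simp [homg, add_mul, Finset.sum_add_distrib]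

theorem homg_C_mul (n : ℕ) (c : ℂ) (p : Polynomial ℂ) :
    homg n (Polynomial.C c * p) = C c * homg n p := by
  simp [homg, Finset.mul_sum, mul_assoc]

theorem homg_X_mul (n : ℕ) (p : Polynomial ℂ) :
    homg (n + 1) (Polynomial.X * p) = X 0 * homg n p := by
  rw [homg, Finset.sum_range_succ', homg, Finset.mul_sum]
  simp only [Polynomial.coeff_X_mul, Polynomial.mul_coeff_zero, Polynomial.coeff_X_zero, zero_mul,
    map_zero, add_zero]
  apply Finset.sum_congr rfl
  intro i _
  rw [show n + 1 - (i + 1) = n - i by omega]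
  ring

theorem homg_one_mul (n : ℕ) (p : Polynomial ℂ) (hp : p.natDegree ≤ n) :
    homg (n + 1) p = X 1 * homg n p := by
  rw [homg, Finset.sum_range_succ, homg, Finset.mul_sum,
    Polynomial.coeff_eq_zero_of_natDegree_lt (show p.natDegree < n + 1 by omega)]
  simp only [map_zero, zero_mul, add_zero]
  apply Finset.sum_congr rfl
  intro i hi
  rw [show n + 1 - i = (n - i) + 1 by have := Finset.mem_range.mp hi; omega]
  ring

theorem theta_spec (a b : ℂ) (n : ℕ) (Φ : TP) (hΦ : Φ.IsHomogeneous n) :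
    (theta a b Φ).natDegree ≤ n ∧
      (X 2 - C a * X 0 - C b * X 1 : TP) ∣ Φ - homg n (theta a b Φ) := by
  have h : Φ ∈ (homogeneousSubmodule (Fin 3) ℂ 1) ^ n := by
    rw [homogeneousSubmodule_one_pow]; exact hΦ
  clear hΦ
  induction h using Submodule.pow_induction_on_left' with
  | algebraMap r =>
    simp [homg]
  | add x y i hx hy h1 h2 =>
    refine ⟨?_, ?_⟩
    · rw [map_add]
      exact (Polynomial.natDegree_add_le _ _).trans (max_le h1.1 h2.1)
    · rw [map_add, homg_add]
      convert dvd_add h1.2 h2.2 using 1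
      ring
  | mem_mul l hl i x hx ih =>
    rw [homogeneousSubmodule_one_eq_span_X] at hl
    induction hl using Submodule.span_induction with
    | zero => simp [homg]
    | add u v _ _ h1 h2 =>
      refine ⟨?_, ?_⟩
      · rw [add_mul, map_add]
        exact (Polynomial.natDegree_add_le _ _).trans (max_le h1.1 h2.1)
      · rw [add_mul, map_add, homg_add]
        convert dvd_add h1.2 h2.2 using 1
        ring
    | smul c u _ h1 =>
      rw [smul_mul_assoc, map_smul]
      refine ⟨(Polynomial.natDegree_smul_le _ _).trans h1.1, ?_⟩
      rw [Polynomial.smul_eq_C_mul, homg_C_mul, MvPolynomial.smul_eq_C_mul]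
      convert dvd_mul_of_dvd_right h1.2 (C c) using 1
      ring
    | mem u hu =>
      obtain ⟨j, rfl⟩ := hu
      obtain ⟨hd, hv⟩ := ih
      have hX : (Polynomial.X * theta a b x).natDegree ≤ i + 1 :=
        (Polynomial.natDegree_mul_le).trans (by rw [Polynomial.natDegree_X]; omega)
      fin_cases j
      · have e : theta a b (X 0 * x) = Polynomial.X * theta a b x := by
          rw [map_mul]; simp [theta]
        simp only [Fin.zero_eta, Nat.succ_eq_add_one]
        rw [e, homg_X_mul]
        refine ⟨hX, ?_⟩
        convert dvd_mul_of_dvd_right hv (X 0) using 1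
        ring
      · have e : theta a b (X 1 * x) = theta a b x := by
          rw [map_mul]; simp [theta]
        simp only [Fin.mk_one, Nat.succ_eq_add_one]
        rw [e, homg_one_mul _ _ hd]
        refine ⟨by omega, ?_⟩
        convert dvd_mul_of_dvd_right hv (X 1) using 1
        ring
      · have e : theta a b (X 2 * x) = Polynomial.C a * (Polynomial.X * theta a b x)
            + Polynomial.C b * theta a b x := by
          rw [map_mul]; simp [theta]; ring
        simp only [Fin.reduceFinMk, Nat.succ_eq_add_one]
        rw [e, homg_add, homg_C_mul, homg_C_mul, homg_X_mul, homg_one_mul _ _ hd]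
        refine ⟨?_, ?_⟩
        · refine (Polynomial.natDegree_add_le _ _).trans (max_le ?_ ?_)
          · exact (Polynomial.natDegree_C_mul_le _ _).trans hX
          · exact (Polynomial.natDegree_C_mul_le _ _).trans (by omega)
        · obtain ⟨w, hw⟩ := hv
          refine ⟨x + (C a * X 0 + C b * X 1) * w, ?_⟩
          rw [sub_eq_iff_eq_add] at hw
          linear_combination (C a * X 0 + C b * X 1) * hw

theorem theta_coeff (a b : ℂ) (n : ℕ) (Φ : TP) (hΦ : Φ.IsHomogeneous n) :
    (theta a b Φ).coeff n = MvPolynomial.eval ![1, 0, a] Φ := by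
  obtain ⟨h1, ⟨w, hw⟩⟩ := theta_spec a b n Φ hΦ
  have := congrArg (MvPolynomial.eval ![1, 0, a]) hw
  simp only [map_sub, map_mul, eval_X, eval_C] at this
  simp at this
  rw [sub_eq_zero] at this
  rw [this, homg, map_sum, Finset.sum_range_succ, Finset.sum_eq_zero]
  · simp
  · intro i hi
    have : n - i ≠ 0 := by have := Finset.mem_range.mp hi; omega
    simp [this]

theorem theta_eval (a b t : ℂ) (Φ : TP) :
    (theta a b Φ).eval t = MvPolynomial.eval ![t, 1, a * t + b] Φ := by
  induction Φ using MvPolynomial.induction_on with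
  | C c => simp [theta]
  | add p q hp hq => simp [hp, hq]
  | mul_X p i hp =>
    rw [map_mul, map_mul, Polynomial.eval_mul, hp]
    congr 1
    fin_cases i <;> simp [theta]

theorem bez_div (f g p : Polynomial ℂ) (k n : ℕ) (hfg : IsCoprime f g) (hf : f.natDegree = k)
    (hf0 : f ≠ 0) (hg : g.natDegree ≤ k) (hp : p.natDegree ≤ n) (hn : 2 * k ≤ n + 1) :
    ∃ u v : Polynomial ℂ, p = u * f + v * g ∧ u.natDegree + k ≤ n ∧ v.natDegree + k ≤ n := by
  obtain ⟨s, t, hst⟩ := hfg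
  have hkn : k ≤ n := by omega
  set v := (p * t) % f with hv
  set u := p * s + g * ((p * t) / f) with hu
  have e : p = u * f + v * g := by
    have := EuclideanDomain.div_add_mod (p * t) f
    rw [← hv] at this
    rw [hu]
    linear_combination -p * hst - g * this
  have hvd : v.natDegree + k ≤ n ∧ (v * g).natDegree ≤ n := by
    by_cases h0 : v = 0
    · rw [h0]; simp [hkn]
    · have h1 : v.degree < f.degree := Polynomial.degree_mod_lt _ hf0
      have h2 : v.natDegree < k := hf ▸ Polynomial.natDegree_lt_natDegree h0 h1
      have h3 := Polynomial.natDegree_mul_le (p := v) (q := g)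
      omega
  refine ⟨u, v, e, ?_, hvd.1⟩
  by_cases h0 : u = 0
  · rw [h0]; simp [hkn]
  · rw [← hf, ← Polynomial.natDegree_mul h0 hf0]
    have : u * f = p - v * g := by rw [e]; ring
    rw [this]
    exact (Polynomial.natDegree_sub_le _ _).trans (max_le hp hvd.2)

theorem surj_step (a b : ℂ) (F G : TP) (k D : ℕ) (hF : F.IsHomogeneous k) (hG : G.IsHomogeneous k)
    (hco : IsCoprime (theta a b F) (theta a b G)) (hne : MvPolynomial.eval ![1, 0, a] F ≠ 0)
    (hD : 2 * k ≤ D + 1) (Φ : TP) (hΦ : Φ.IsHomogeneous (D + 1)) :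
    ∃ Ψ U V : TP, Ψ.IsHomogeneous D ∧
      Φ = (X 2 - C a * X 0 - C b * X 1 : TP) * Ψ + U * F + V * G := by
  have hfc := theta_coeff a b k F hF
  have hf0 : theta a b F ≠ 0 := by
    intro h; rw [h] at hfc; exact hne (by rw [← hfc]; simp)
  have hfd : (theta a b F).natDegree = k :=
    le_antisymm (theta_spec a b k F hF).1 (Polynomial.le_natDegree_of_ne_zero (by rwa [hfc]))
  obtain ⟨u, v, e, hu, hv⟩ := bez_div _ _ _ k (D + 1) hco hfd hf0 (theta_spec a b k G hG).1
    (theta_spec a b (D + 1) Φ hΦ).1 (by omega)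
  set N := D + 1 - k with hN
  have hNk : N + k = D + 1 := by omega
  have hU := (homg_isHom N u).mul hF
  have hV := (homg_isHom N v).mul hG
  rw [hNk] at hU hV
  have h1 := (hΦ.sub hU).sub hV
  have h0 : theta a b (Φ - homg N u * F - homg N v * G) = 0 := by
    rw [map_sub, map_sub, map_mul, map_mul, theta_homg _ _ _ _ (by omega),
      theta_homg _ _ _ _ (by omega), e]
    ring
  obtain ⟨_, ⟨w, hw⟩⟩ := theta_spec a b (D + 1) _ h1
  rw [h0] at hw
  have hz : homg (D + 1) 0 = 0 := by simp [homg]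
  rw [hz, sub_zero] at hw
  have hl : (X 2 - C a * X 0 - C b * X 1 : TP).IsHomogeneous 1 :=
    ((isHomogeneous_X ℂ 2).sub (isHomogeneous_C_mul_X a 0)).sub (isHomogeneous_C_mul_X b 1)
  have h2 := hc_mul hl D w
  rw [← hw, add_comm 1 D, homogeneousComponent_eq_self h1] at h2
  refine ⟨homogeneousComponent D w, homg N u, homg N v, homogeneousComponent_isHomogeneous _ _, ?_⟩
  linear_combination h2

/-- multiplication by a form of degree `k`, from degree `n` to degree `k + n` -/
noncomputable def mulForm (F : TP) (k n : ℕ) (hF : F.IsHomogeneous k) :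
    homogeneousSubmodule (Fin 3) ℂ n →ₗ[ℂ] homogeneousSubmodule (Fin 3) ℂ (k + n) where
  toFun w := ⟨F * w.1, hF.mul w.2⟩
  map_add' u v := by ext1; simp [mul_add]
  map_smul' c v := by ext1; simp

/-- binary form with given coefficients -/
noncomputable def binForm (i j : Fin 3) (n : ℕ) :
    (Fin (n + 1) → ℂ) →ₗ[ℂ] homogeneousSubmodule (Fin 3) ℂ n where
  toFun c := ⟨∑ l : Fin (n + 1), C (c l) * (X i ^ (l : ℕ) * X j ^ (n - (l : ℕ))), by
    apply IsHomogeneous.sum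
    intro l _
    apply IsHomogeneous.C_mul
    have h := (isHomogeneous_X_pow (R := ℂ) i (l : ℕ)).mul (isHomogeneous_X_pow j (n - l))
    rwa [show (l : ℕ) + (n - l) = n by omega] at h⟩
  map_add' u v := by ext1; simp [add_mul, Finset.sum_add_distrib]
  map_smul' c v := by
    ext1; simp [Finset.smul_sum, MvPolynomial.smul_eq_C_mul, mul_assoc]

theorem choose_two_cast (n : ℕ) : 2 * (((n + 2).choose 2 : ℕ) : ℤ) = (n + 2) * (n + 1) := by
  have h := Nat.triangle_succ (n + 1)
  have h2 := Nat.choose_two_right (n + 2)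
  have h3 := Nat.div_two_mul_two_of_even (Nat.even_mul_pred_self (n + 2))
  rw [← h2] at h3
  simp only [show n + 2 - 1 = n + 1 by omega] at h3
  have : (((n + 2).choose 2 * 2 : ℕ) : ℤ) = (((n + 2) * (n + 1) : ℕ) : ℤ) := by rw [h3]
  push_cast at this
  linarith

theorem elim_exists (F G : TP) (k : ℕ) (hF : F.IsHomogeneous k) (hG : G.IsHomogeneous k)
    (hF0 : F ≠ 0) (hrel : IsRelPrime F G) (i j : Fin 3) :
    ∃ q : Polynomial ℂ, q ≠ 0 ∧ ∀ P : Fin 3 → ℂ, MvPolynomial.eval P F = 0 →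
      MvPolynomial.eval P G = 0 → P j = 1 → q.eval (P i) = 0 := by
  classical
  by_contra hcon
  set K := k * k with hK
  have ek : k + (k + K) = 2 * k + K := by omega
  set n := k + (k + K) with hn
  let S := homogeneousSubmodule (Fin 3) ℂ (k + K)
  let Λ : (S × S × (Fin (n + 1) → ℂ)) →ₗ[ℂ] homogeneousSubmodule (Fin 3) ℂ n :=
    (mulForm F k (k + K) hF).coprod ((mulForm G k (k + K) hG).coprod (binForm i j n))
  have hΛ : ∀ x, (Λ x).1 = F * x.1.1 + (G * x.2.1.1 +
      ∑ l : Fin (n + 1), C (x.2.2 l) * (X i ^ (l : ℕ) * X j ^ (n - (l : ℕ)))) := fun x => rfl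
  let M : homogeneousSubmodule (Fin 3) ℂ K →ₗ[ℂ] (S × S × (Fin (n + 1) → ℂ)) :=
    (mulForm G k K hG).prod ((-(mulForm F k K hF)).prod 0)
  have hker : LinearMap.ker Λ ≤ LinearMap.range M := by
    rintro ⟨u, v, c⟩ hx
    have h0 : F * u.1 + (G * v.1 +
      ∑ l : Fin (n + 1), C (c l) * (X i ^ (l : ℕ) * X j ^ (n - (l : ℕ)))) = 0 := by
      have := hΛ (u, v, c)
      rw [LinearMap.mem_ker.mp hx] at this
      exact this.symm
    have hc : c = 0 := by
      by_contra hc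
      apply hcon
      refine ⟨∑ l : Fin (n + 1), Polynomial.C (c l) * Polynomial.X ^ (l : ℕ), ?_, ?_⟩
      · intro hq
        apply hc
        ext l
        have := congrArg (fun p => Polynomial.coeff p (l : ℕ)) hq
        simpa [Polynomial.coeff_X_pow, Fin.val_inj, Finset.sum_ite_eq] using this
      · intro P h1 h2 h3
        have := congrArg (MvPolynomial.eval P) h0
        simp only [map_add, map_mul, h1, h2, zero_mul, zero_add, map_sum, eval_C, map_pow, eval_X,
          h3, one_pow, mul_one, map_zero] at this
        simpa [Polynomial.eval_finsetSum] using this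
    subst hc
    simp only [Pi.zero_apply, map_zero, zero_mul, Finset.sum_const_zero, add_zero] at h0
    have hd : F ∣ G * v.1 := ⟨-u.1, by linear_combination h0⟩
    obtain ⟨w, hw⟩ := hrel.dvd_of_dvd_mul_left hd
    have hu : u.1 = - (G * w) := by
      apply mul_left_cancel₀ hF0
      rw [hw] at h0
      linear_combination h0
    have e1 := hc_mul hF K w
    rw [← hw, homogeneousComponent_eq_self v.2] at e1
    have e2 := hc_mul hG K w
    have e3 : G * w = - u.1 := by rw [hu]; ring
    rw [e3, map_neg, homogeneousComponent_eq_self u.2] at e2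
    refine ⟨⟨-homogeneousComponent K w, (homogeneousComponent_isHomogeneous K w).neg⟩, ?_⟩
    refine Prod.ext ?_ (Prod.ext ?_ rfl)
    · apply Subtype.ext
      change G * (-homogeneousComponent K w) = u.1
      linear_combination e2
    · apply Subtype.ext
      change -(F * (-homogeneousComponent K w)) = v.1
      linear_combination -e1
  have d1 := LinearMap.finrank_range_add_finrank_ker Λ
  have d2 := Submodule.finrank_le (LinearMap.range Λ)
  have d3 := Submodule.finrank_mono hker
  have d4 := LinearMap.finrank_range_le M
  rw [Module.finrank_prod, Module.finrank_prod, Module.finrank_fin_fun] at d1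
  rw [finrank_homog] at d1 d2 d4
  have c1 := choose_two_cast n
  have c2 := choose_two_cast (k + K)
  have c3 := choose_two_cast K
  have d5 : (2 * (k + K + 2).choose 2 + (n + 1) : ℤ) ≤ (n + 2).choose 2 + (K + 2).choose 2 := by
    exact_mod_cast (by omega)
  have hn' : (n : ℤ) = k + (k + K) := by rw [hn]; push_cast; ring
  rw [hn'] at c1 d5
  have hK' : (K : ℤ) = k * k := by rw [hK]; push_cast; ring
  push_cast at c1 c2 c3 d5
  nlinarith [c1, c2, c3, d5, hK']

theorem line_exists (F G : TP) (k : ℕ) (hF : F.IsHomogeneous k) (hG : G.IsHomogeneous k)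
    (hF0 : F ≠ 0) (hrel : IsRelPrime F G) :
    ∃ a b : ℂ, IsCoprime (theta a b F) (theta a b G) ∧
      (MvPolynomial.eval ![1, 0, a] F ≠ 0 ∨ MvPolynomial.eval ![1, 0, a] G ≠ 0) := by
  classical
  obtain ⟨q1, h1, e1⟩ := elim_exists F G k hF hG hF0 hrel 0 1
  obtain ⟨q2, h2, e2⟩ := elim_exists F G k hF hG hF0 hrel 2 1
  obtain ⟨q3, h3, e3⟩ := elim_exists F G k hF hG hF0 hrel 2 0
  obtain ⟨a, ha⟩ := Infinite.exists_notMem_finset q3.roots.toFinset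
  obtain ⟨b, hb⟩ := Infinite.exists_notMem_finset
    (q1.roots.toFinset.biUnion fun t => q2.roots.toFinset.image fun s => s - a * t)
  refine ⟨a, b, ?_, ?_⟩
  · have hno : ∀ t : ℂ, (theta a b F).eval t = 0 → (theta a b G).eval t = 0 → False := by
      intro t hf hg
      rw [theta_eval] at hf hg
      have r1 := e1 _ hf hg (by simp)
      have r2 := e2 _ hf hg (by simp)
      simp at r1 r2
      apply hb
      simp only [Finset.mem_biUnion, Finset.mem_image, Multiset.mem_toFinset,
        Polynomial.mem_roots h1, Polynomial.mem_roots h2]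
      exact ⟨t, r1, a * t + b, r2, by ring⟩
    by_contra hc
    rw [← EuclideanDomain.gcd_isUnit_iff, Polynomial.isUnit_iff_degree_eq_zero] at hc
    obtain ⟨t, ht⟩ := IsAlgClosed.exists_root _ hc
    exact hno t (ht.dvd (EuclideanDomain.gcd_dvd_left _ _))
      (ht.dvd (EuclideanDomain.gcd_dvd_right _ _))
  · by_contra hc
    push Not at hc
    have := e3 _ hc.1 hc.2 (by simp)
    apply ha
    simpa [Polynomial.mem_roots h3] using this

/-- weights supported on a complete intersection of two curves of degree `k`
which give a relation in degree `≥ 2 * k - 1` are trivial -/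
theorem ci_indep (F G : TP) (k D : ℕ) (hF : F.IsHomogeneous k) (hG : G.IsHomogeneous k)
    (hF0 : F ≠ 0) (hrel : IsRelPrime F G) (hD : 2 * k ≤ D + 1)
    (Z : Finset (Proj 2)) (w : Proj 2 → ℂ)
    (hw : ∀ P ∈ Z, w P ≠ 0 → MvPolynomial.eval P.rep F = 0 ∧ MvPolynomial.eval P.rep G = 0)
    (hrelw : ∀ Φ : TP, Φ.IsHomogeneous D → ∑ P ∈ Z, w P * MvPolynomial.eval P.rep Φ = 0) :
    ∀ P ∈ Z, w P = 0 := by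
  classical
  obtain ⟨a, b, hco, hor⟩ := line_exists F G k hF hG hF0 hrel
  set l : TP := X 2 - C a * X 0 - C b * X 1 with hl
  have hlh : l.IsHomogeneous 1 :=
    ((isHomogeneous_X ℂ 2).sub (isHomogeneous_C_mul_X a 0)).sub (isHomogeneous_C_mul_X b 1)
  -- one step
  have step : ∀ (D' : ℕ), D ≤ D' → ∀ Φ : TP, Φ.IsHomogeneous (D' + 1) →
      ∃ Ψ U V : TP, Ψ.IsHomogeneous D' ∧ Φ = l * Ψ + U * F + V * G := by
    intro D' hD' Φ hΦ
    rcases hor with h | h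
    · exact surj_step a b F G k D' hF hG hco h (by omega) Φ hΦ
    · obtain ⟨Ψ, U, V, h1, h2⟩ := surj_step a b G F k D' hG hF hco.symm h (by omega) Φ hΦ
      exact ⟨Ψ, V, U, h1, by rw [h2]; ring⟩
  have steps : ∀ (i : ℕ) (Φ : TP), Φ.IsHomogeneous (D + i) →
      ∃ Ψ U V : TP, Ψ.IsHomogeneous D ∧ Φ = l ^ i * Ψ + U * F + V * G := by
    intro i
    induction i with
    | zero => intro Φ hΦ; exact ⟨Φ, 0, 0, hΦ, by simp⟩
    | succ i ih =>
      intro Φ hΦ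
      obtain ⟨Ψ, U, V, h1, h2⟩ := step (D + i) (by omega) Φ hΦ
      obtain ⟨Ψ', U', V', h3, h4⟩ := ih Ψ h1
      exact ⟨Ψ', U + l * U', V + l * V', h3, by rw [h2, h4]; ring⟩
  have hl0 : ∀ P : Proj 2, MvPolynomial.eval P.rep F = 0 → MvPolynomial.eval P.rep G = 0 →
      MvPolynomial.eval P.rep l ≠ 0 := by
    intro P hPF hPG hPl
    set v := P.rep with hv
    have hv0 : v ≠ 0 := P.rep_nonzero
    have hz : v 2 = a * v 0 + b * v 1 := by
      simp only [hl, map_sub, map_mul, eval_X, eval_C] at hPl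
      linear_combination hPl
    have hsc : ∀ (c : ℂ) (Φ : TP) (n : ℕ), Φ.IsHomogeneous n → MvPolynomial.eval v Φ = 0 →
        MvPolynomial.eval (c • v) Φ = 0 := by
      intro c Φ n hΦ h0
      have : MvPolynomial.eval (c • v) Φ = c ^ n * MvPolynomial.eval v Φ := by
        rw [MvPolynomial.eval_eq', MvPolynomial.eval_eq', Finset.mul_sum]
        apply Finset.sum_congr rfl
        intro s hs
        have hd := hΦ (mem_support_iff.mp hs)
        rw [Pi.one_def, ← Finsupp.degree_eq_weight_one, Finsupp.degree_eq_sum] at hd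
        simp only [Pi.smul_apply, smul_eq_mul, mul_pow, Finset.prod_mul_distrib]
        rw [Finset.prod_pow_eq_pow_sum, hd]
        ring
      rw [this, h0, mul_zero]
    by_cases hy : v 1 = 0
    · have hx : v 0 ≠ 0 := by
        intro hx
        apply hv0
        ext i
        fin_cases i <;> simp [hx, hy, hz]
      have e : (v 0)⁻¹ • v = ![1, 0, a] := by
        ext i
        fin_cases i <;> simp [hx, hy, hz]
        field_simp
      have f1 := hsc (v 0)⁻¹ F k hF hPF
      have f2 := hsc (v 0)⁻¹ G k hG hPG
      rw [e] at f1 f2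
      tauto
    · have e : (v 1)⁻¹ • v = ![v 0 / v 1, 1, a * (v 0 / v 1) + b] := by
        ext i
        fin_cases i <;> simp [hy, hz] <;> field_simp
      have f1 := hsc (v 1)⁻¹ F k hF hPF
      have f2 := hsc (v 1)⁻¹ G k hG hPG
      rw [e, ← theta_eval] at f1 f2
      obtain ⟨s, t, hst⟩ := hco
      have := congrArg (Polynomial.eval (v 0 / v 1)) hst
      simp [f1, f2] at this
  -- separating forms
  have sep : ∀ P Q : Proj 2, Q ≠ P → ∃ h : TP, h.IsHomogeneous 1 ∧
      MvPolynomial.eval Q.rep h = 0 ∧ MvPolynomial.eval P.rep h ≠ 0 := by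
    intro P Q hne
    by_contra hcon
    push Not at hcon
    apply hne
    obtain ⟨i, hi⟩ := Function.ne_iff.mp Q.rep_nonzero
    simp only [Pi.zero_apply] at hi
    have hall : ∀ j, Q.rep i * P.rep j = Q.rep j * P.rep i := by
      intro j
      have := hcon (C (Q.rep i) * X j - C (Q.rep j) * X i)
        ((isHomogeneous_C_mul_X _ j).sub (isHomogeneous_C_mul_X _ i)) (by simp; ring)
      simp at this
      linear_combination this
    rw [← Projectivization.mk_rep Q, ← Projectivization.mk_rep P,
      Eq.comm, Projectivization.mk_eq_mk_iff']
    refine ⟨P.rep i / Q.rep i, ?_⟩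
    ext j
    simp only [Pi.smul_apply, smul_eq_mul]
    field_simp
    rw [mul_comm, ← hall j, mul_comm]
  intro P hP
  by_contra hwP
  choose! h hh1 hh2 hh3 using sep P
  set Φ : TP := l ^ D * ∏ Q ∈ Z.erase P, h Q with hΦ
  have hΦh : Φ.IsHomogeneous (D + (Z.erase P).card) := by
    have e1 := hlh.pow D
    have e2 := IsHomogeneous.prod (Z.erase P) h (fun _ => 1)
      (fun Q hQ => hh1 Q (Finset.ne_of_mem_erase hQ))
    have := e1.mul e2
    simpa using this
  have hΦP : MvPolynomial.eval P.rep Φ ≠ 0 := by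
    rw [hΦ, map_mul, map_pow, map_prod]
    obtain ⟨q1, q2⟩ := hw P hP hwP
    refine mul_ne_zero (pow_ne_zero _ (hl0 P q1 q2)) (Finset.prod_ne_zero_iff.mpr ?_)
    intro Q hQ
    exact hh3 Q (Finset.ne_of_mem_erase hQ)
  have hΦQ : ∀ Q ∈ Z, Q ≠ P → MvPolynomial.eval Q.rep Φ = 0 := by
    intro Q hQ hne
    rw [hΦ, map_mul, map_prod, Finset.prod_eq_zero (Finset.mem_erase.mpr ⟨hne, hQ⟩) (hh2 Q hne),
      mul_zero]
  obtain ⟨Ψ, U, V, hΨ, e⟩ := steps _ Φ hΦh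
  have ev : ∀ Q ∈ Z, w Q ≠ 0 → MvPolynomial.eval Q.rep Φ =
      MvPolynomial.eval Q.rep l ^ (Z.erase P).card * MvPolynomial.eval Q.rep Ψ := by
    intro Q hQ hwQ
    obtain ⟨q1, q2⟩ := hw Q hQ hwQ
    rw [e]
    simp [q1, q2]
  have hs := hrelw Ψ hΨ
  rw [Finset.sum_eq_single_of_mem P hP] at hs
  · rcases mul_eq_zero.mp hs with h | h
    · exact hwP h
    · apply hΦP
      rw [ev P hP hwP, h, mul_zero]
  · intro Q hQ hne
    by_cases hwQ : w Q = 0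
    · rw [hwQ, zero_mul]
    · have := ev Q hQ hwQ
      rw [hΦQ Q hQ hne] at this
      obtain ⟨q1, q2⟩ := hw Q hQ hwQ
      rcases mul_eq_zero.mp this.symm with h | h
      · exact absurd h (pow_ne_zero _ (hl0 Q q1 q2))
      · rw [h, mul_zero]

instance fd_homog' (n : ℕ) : FiniteDimensional ℂ (homogeneousSubmodule (Fin (2 + 1)) ℂ n) :=
  fd_homog n

theorem evalMap_surj_of_card {Z : Finset (Proj 2)} {j : ℕ} (h : hilbN 2 Z j = Z.card) :
    Function.Surjective (evalMap 2 j Z) := by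
  rw [← LinearMap.range_eq_top]
  apply Submodule.eq_top_of_finrank_eq
  rw [Module.finrank_fintype_fun_eq_card, Fintype.card_coe]
  exact h

theorem hilbN_of_surj {Z : Finset (Proj 2)} {j : ℕ} (h : Function.Surjective (evalMap 2 j Z)) :
    hilbN 2 Z j = Z.card := by
  rw [hilbN, LinearMap.range_eq_top.mpr h, finrank_top, Module.finrank_fintype_fun_eq_card,
    Fintype.card_coe]

theorem surj_of_indep {Z : Finset (Proj 2)} {j : ℕ}
    (h : LinearIndependent ℂ (fun P : Z => vero 2 j P.1)) :
    Function.Surjective (evalMap 2 j Z) := by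
  classical
  rw [← LinearMap.range_eq_top]
  by_contra hne
  obtain ⟨f, hf0, hf⟩ := Submodule.exists_le_ker_of_lt_top _ (lt_top_iff_ne_top.mpr hne)
  apply hf0
  set c : Proj 2 → ℂ := fun P => if hP : P ∈ Z then f (Pi.single ⟨P, hP⟩ 1) else 0 with hc
  have hcP : ∀ P : Z, c P.1 = f (Pi.single P 1) := by
    intro P; simp [hc]
  have hfe : ∀ g : Z → ℂ, f g = ∑ P : Z, c P.1 * g P := by
    intro g
    rw [LinearMap.pi_apply_eq_sum_univ f g]
    apply Finset.sum_congr rfl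
    intro P _
    rw [hcP, smul_eq_mul, mul_comm]
    congr 2
    ext Q
    simp [Pi.single_apply, eq_comm]
  have hrel : ∑ P ∈ Z, c P • vero 2 j P = 0 := by
    rw [relation_iff]
    intro Φ hΦ
    have h1 : evalMap 2 j Z ⟨Φ, hΦ⟩ ∈ LinearMap.ker f := hf ⟨_, rfl⟩
    rw [LinearMap.mem_ker, hfe] at h1
    rw [← Finset.sum_coe_sort]
    exact h1
  rw [← Finset.sum_coe_sort] at hrel
  have h0 := Fintype.linearIndependent_iff.mp h (fun P => c P.1) hrel
  ext P
  simp [← hcP, h0]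

theorem surj_mono {A Z : Finset (Proj 2)} {j : ℕ} (hAZ : A ⊆ Z)
    (h : Function.Surjective (evalMap 2 j Z)) : Function.Surjective (evalMap 2 j A) := by
  classical
  intro g
  obtain ⟨Φ, hΦ⟩ := h (fun P => if hP : P.1 ∈ A then g ⟨P.1, hP⟩ else 0)
  refine ⟨Φ, ?_⟩
  ext P
  have := congrFun hΦ ⟨P.1, hAZ P.2⟩
  simp only [P.2, dite_true] at this
  exact this

theorem hilbN_mono {A Z : Finset (Proj 2)} (j : ℕ) (hAZ : A ⊆ Z) :
    hilbN 2 A j ≤ hilbN 2 Z j := by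
  let ρ : (Z → ℂ) →ₗ[ℂ] (A → ℂ) := LinearMap.funLeft ℂ ℂ (fun P : A => (⟨P.1, hAZ P.2⟩ : Z))
  have e : evalMap 2 j A = ρ ∘ₗ evalMap 2 j Z := rfl
  rw [hilbN, hilbN, e, LinearMap.range_comp]
  exact Submodule.finrank_map_le _ _

theorem hilbN_add_ker (Z : Finset (Proj 2)) (j : ℕ) :
    hilbN 2 Z j + Module.finrank ℂ (LinearMap.ker (evalMap 2 j Z)) = (j + 2).choose 2 := by
  rw [← finrank_homog]
  exact LinearMap.finrank_range_add_finrank_ker (evalMap 2 j Z)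

theorem hilbN_pair (Z : Finset (Proj 2)) (c : Proj 2 → ℂ) (hc : ∀ P ∈ Z, c P ≠ 0) (i j : ℕ)
    (hrel : ∀ Φ : TP, Φ.IsHomogeneous (i + j) → ∑ P ∈ Z, c P * MvPolynomial.eval P.rep Φ = 0) :
    hilbN 2 Z i + hilbN 2 Z j ≤ Z.card := by
  classical
  let Λ : (Z → ℂ) →ₗ[ℂ] Module.Dual ℂ (Z → ℂ) :=
    LinearMap.mk₂ ℂ (fun f g => ∑ P : Z, c P.1 * (f P * g P))
      (by intros; simp [add_mul, mul_add, Finset.sum_add_distrib])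
      (by intros; simp only [Pi.smul_apply, smul_eq_mul, Finset.mul_sum]
          exact Finset.sum_congr rfl (by intros; ring))
      (by intros; simp [mul_add, Finset.sum_add_distrib])
      (by intros; simp only [Pi.smul_apply, smul_eq_mul, Finset.mul_sum]
          exact Finset.sum_congr rfl (by intros; ring))
  have hΛ : ∀ f g, Λ f g = ∑ P : Z, c P.1 * (f P * g P) := fun f g => rfl
  have hinj : Function.Injective Λ := by
    rw [← LinearMap.ker_eq_bot, LinearMap.ker_eq_bot']
    intro f hf
    ext P
    have := congrArg (fun φ => φ (Pi.single P 1)) hf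
    simp only [hΛ] at this
    simpa [Pi.single_apply, hc P.1 P.2] using this
  have hle : (LinearMap.range (evalMap 2 i Z)).map Λ ≤
      (LinearMap.range (evalMap 2 j Z)).dualAnnihilator := by
    rintro _ ⟨_, ⟨Φ, rfl⟩, rfl⟩
    rw [Submodule.mem_dualAnnihilator]
    rintro _ ⟨Ψ, rfl⟩
    rw [hΛ]
    have := hrel (Φ.1 * Ψ.1) (Φ.2.mul Ψ.2)
    rw [← Finset.sum_coe_sort] at this
    simpa [evalMap] using this
  have d1 := Submodule.finrank_mono hle
  rw [(Submodule.equivMapOfInjective Λ hinj _).symm.finrank_eq] at d1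
  have d2 := Subspace.finrank_add_finrank_dualAnnihilator_eq (LinearMap.range (evalMap 2 j Z))
  rw [Module.finrank_fintype_fun_eq_card, Fintype.card_coe] at d2
  rw [hilbN, hilbN]
  omega

theorem no_low_curve {Z : Finset (Proj 2)} {m : ℕ} (h : (m + 2).choose 2 ≤ hilbN 2 Z m)
    {H : TP} {e : ℕ} (he : e ≤ m) (hH : H.IsHomogeneous e)
    (hv : ∀ P ∈ Z, MvPolynomial.eval P.rep H = 0) : H = 0 := by
  have hk := hilbN_add_ker Z m
  have h0 : Module.finrank ℂ (LinearMap.ker (evalMap 2 m Z)) = 0 := by omega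
  rw [Submodule.finrank_eq_zero] at h0
  have hh : (H * X 0 ^ (m - e)).IsHomogeneous m := by
    have := hH.mul (isHomogeneous_X_pow (R := ℂ) (0 : Fin 3) (m - e))
    rwa [show e + (m - e) = m by omega] at this
  have hm : (⟨_, hh⟩ : homogeneousSubmodule (Fin 3) ℂ m) ∈ LinearMap.ker (evalMap 2 m Z) := by
    rw [LinearMap.mem_ker]
    ext P
    simp [evalMap, hv P.1 P.2]
  rw [h0, Submodule.mem_bot] at hm
  have := congrArg Subtype.val hm
  simp only [ZeroMemClass.coe_zero] at this
  rcases mul_eq_zero.mp this with h | h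
  · exact h
  · exact absurd h (pow_ne_zero _ (X_ne_zero _))

theorem core (m : ℕ) (Z : Finset (Proj 2)) (c : Proj 2 → ℂ) (hc : ∀ P ∈ Z, c P ≠ 0)
    (hrel : ∀ Φ : TP, Φ.IsHomogeneous (2 * m + 1) →
      ∑ P ∈ Z, c P * MvPolynomial.eval P.rep Φ = 0)
    (hN : (m + 2).choose 2 ≤ hilbN 2 Z m) (hcard : Z.card ≤ 2 * (m + 2).choose 2 + m) : False := by
  classical
  have hp := hilbN_pair Z c hc m (m + 1) (by
    rwa [show m + (m + 1) = 2 * m + 1 by omega])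
  have hk := hilbN_add_ker Z (m + 1)
  have hch : (m + 1 + 2).choose 2 = (m + 2).choose 2 + (m + 2) := by
    rw [Nat.choose_succ_succ' (m + 2) 1]; simp; ring
  have hdim : 1 < Module.finrank ℂ (LinearMap.ker (evalMap 2 (m + 1) Z)) := by omega
  obtain ⟨F, hF0⟩ : ∃ F : LinearMap.ker (evalMap 2 (m + 1) Z), F ≠ 0 := by
    have : Nontrivial (LinearMap.ker (evalMap 2 (m + 1) Z)) :=
      Module.nontrivial_of_finrank_pos (R := ℂ) (by omega)
    exact exists_ne 0
  obtain ⟨G, hFG⟩ := exists_linearIndependent_pair_of_one_lt_finrank (R := ℂ)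
    (M := LinearMap.ker (evalMap 2 (m + 1) Z)) hdim (x := F) hF0
  have hli := LinearIndependent.pair_iff.mp hFG
  have hFv : ∀ P ∈ Z, MvPolynomial.eval P.rep F.1.1 = 0 := fun P hP =>
    congrFun (LinearMap.mem_ker.mp F.2) ⟨P, hP⟩
  have hGv : ∀ P ∈ Z, MvPolynomial.eval P.rep G.1.1 = 0 := fun P hP =>
    congrFun (LinearMap.mem_ker.mp G.2) ⟨P, hP⟩
  have hFh : F.1.1.IsHomogeneous (m + 1) := F.1.2
  have hGh : G.1.1.IsHomogeneous (m + 1) := G.1.2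
  have hli' : ∀ s t : ℂ, s • F.1.1 + t • G.1.1 = 0 → s = 0 ∧ t = 0 := by
    intro s t h
    apply hli s t
    apply Subtype.ext
    apply Subtype.ext
    exact h
  have hF0' : F.1.1 ≠ 0 := by
    intro h
    have := hli' 1 0 (by simp [h])
    simp at this
  have hG0' : G.1.1 ≠ 0 := by
    intro h
    have := hli' 0 1 (by simp [h])
    simp at this
  generalize F.1.1 = F at *
  generalize G.1.1 = G at *
  obtain ⟨F', G', H, hrp, hF', hG'⟩ := UniqueFactorizationMonoid.exists_reduced_factors F hF0' G
  subst hF' hG'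
  obtain ⟨e, k, he, hk1, hek⟩ := homog_of_mul hFh hF0'
  obtain ⟨e', k', he', hk2, hek'⟩ := homog_of_mul hGh hG0'
  have hH0 := left_ne_zero_of_mul hF0'
  have hee := he.inj_right he' hH0
  have hkk : k' = k := by omega
  subst hkk
  have hkpos : k' ≠ 0 := by
    rintro rfl
    rw [← totalDegree_zero_iff_isHomogeneous, totalDegree_eq_zero_iff_eq_C] at hk1 hk2
    have := hli' (coeff 0 G') (-coeff 0 F') (by
      rw [hk1, hk2]
      simp only [smul_eq_C_mul, coeff_C, if_true, map_neg]
      ring)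
    apply hF0'
    rw [hk1, neg_eq_zero.mp this.2]
    simp
  have hw := ci_indep F' G' k' (2 * m + 1 - e) hk1 hk2 (right_ne_zero_of_mul hF0') hrp (by omega)
    Z (fun P => c P * MvPolynomial.eval P.rep H) (by
      intro P hP hne
      have hHP := right_ne_zero_of_mul hne
      have h1 := hFv P hP
      have h2 := hGv P hP
      rw [map_mul] at h1 h2
      exact ⟨(mul_eq_zero.mp h1).resolve_left hHP, (mul_eq_zero.mp h2).resolve_left hHP⟩)
    (by
      intro Φ hΦ
      have := hrel (H * Φ) (by
        have := he.mul hΦ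
        rwa [show e + (2 * m + 1 - e) = 2 * m + 1 by omega] at this)
      simpa [mul_assoc] using this)
  exact hH0 (no_low_curve hN (show e ≤ m by omega) he (fun P hP =>
    (mul_eq_zero.mp (hw P hP)).resolve_left (hc P hP)))

theorem computes_iff (d : ℕ) (A : Finset (Proj 2)) (T : TP) :
    Computes 2 d A T ↔ ∃ a : Proj 2 → ℂ, ∑ P ∈ A, a P • vero 2 d P = T := by
  rw [Computes, Submodule.mem_span_image_finset_iff_exists_fun]
  constructor
  · rintro ⟨c, hc⟩
    refine ⟨fun P => if hP : P ∈ A then c ⟨P, hP⟩ else 0, ?_⟩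
    rw [← hc, ← Finset.sum_coe_sort]
    simp
  · rintro ⟨a, ha⟩
    refine ⟨fun P => a P.1, ?_⟩
    rw [← ha]
    exact Finset.sum_coe_sort A (fun P => a P • vero 2 d P)

theorem kruskal_spec (n d : ℕ) (A : Finset (Proj n)) : ∀ A' ⊆ A, A'.card ≤ kruskalRank n d A →
    LinearIndependent ℂ (fun P : A' => vero n d P.1) := by
  have := Nat.sSup_mem (s := {k | k ≤ A.card ∧
    ∀ A' ⊆ A, A'.card ≤ k → LinearIndependent ℂ (fun P : A' => vero n d P.1)})
    ⟨0, Nat.zero_le _, by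
      intro A' _ h
      have : A' = ∅ := by simpa using h
      subst this
      exact linearIndependent_empty_type⟩
    ⟨A.card, fun k hk => hk.1⟩
  exact this.2

theorem stmt3 (m : ℕ) (hm : 2 ≤ m) (d : ℕ) (hd : d = 2 * m + 1)
    (T : MvPolynomial (Fin 3) ℂ) (hT0 : T ≠ 0) (hTh : T.IsHomogeneous d)
    (A : Finset (Proj 2)) (hA : NRComputes 2 d A T) (r : ℕ) (hr : r = A.card)
    (hk : kruskalRank 2 m A = min (Nat.choose (m + 2) 2) r)
    (hh : hilbN 2 A (m + 1) = r)
    (hrb : r ≤ Nat.choose (m + 2) 2 + (m + 1) / 2) :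
    waringRank 2 d T = r := by
  classical
  have hmem : r ∈ {r | ∃ A : Finset (Proj 2), A.card = r ∧ Computes 2 d A T} :=
    ⟨A, hr.symm, hA.1⟩
  apply le_antisymm (Nat.sInf_le hmem)
  by_contra hlt
  push Not at hlt
  obtain ⟨B, hBc, hB⟩ : waringRank 2 d T ∈
    {r | ∃ A : Finset (Proj 2), A.card = r ∧ Computes 2 d A T} := Nat.sInf_mem ⟨r, hmem⟩
  change waringRank 2 d T < r at hlt
  rw [← hBc, hr] at hlt
  obtain ⟨a, ha⟩ := (computes_iff d A T).mp hA.1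
  obtain ⟨b, hb⟩ := (computes_iff d B T).mp hB
  have ha0 : ∀ P ∈ A, a P ≠ 0 := by
    intro P hP h0
    apply hA.2 (A.erase P) (Finset.erase_ssubset hP)
    rw [computes_iff]
    refine ⟨a, ?_⟩
    rw [← ha, ← Finset.add_sum_erase A _ hP, h0, zero_smul, zero_add]
  set c : Proj 2 → ℂ := fun P => (if P ∈ A then a P else 0) - (if P ∈ B then b P else 0) with hc
  set Z := (A ∪ B).filter (fun P => c P ≠ 0) with hZ
  have hcZ : ∀ P ∈ Z, c P ≠ 0 := fun P hP => (Finset.mem_filter.mp hP).2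
  have hrelv : ∑ P ∈ Z, c P • vero 2 d P = 0 := by
    rw [hZ, Finset.sum_filter_of_ne (by
      intro P _ h h0; apply h; rw [h0, zero_smul])]
    simp only [hc, sub_smul, ite_smul, zero_smul, Finset.sum_sub_distrib]
    rw [← Finset.sum_filter, ← Finset.sum_filter]
    have e1 : (A ∪ B).filter (· ∈ A) = A := by ext; simp
    have e2 : (A ∪ B).filter (· ∈ B) = B := by ext; simp
    rw [e1, e2, ha, hb, sub_self]
  have hrel := (relation_iff d Z c).mp hrelv
  set A1 := Z.filter (· ∈ A) with hA1
  have hA1A : A1 ⊆ A := fun P hP => (Finset.mem_filter.mp hP).2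
  have hA1Z : A1 ⊆ Z := Finset.filter_subset _ _
  have hZc : Z.card < 2 * A1.card := by
    have h1 : A \ B ⊆ A1 := by
      intro P hP
      obtain ⟨p1, p2⟩ := Finset.mem_sdiff.mp hP
      simp [hA1, hZ, hc, p1, p2, ha0 P p1]
    have h2 : Z.filter (· ∉ A) ⊆ B \ A := by
      intro P hP
      simp only [hZ, Finset.mem_filter, Finset.mem_union] at hP
      rw [Finset.mem_sdiff]
      tauto
    have h3 := Finset.card_le_card h1
    have h4 := Finset.card_le_card h2
    have h5 := Finset.card_filter_add_card_filter_not (s := Z) (· ∈ A)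
    have h6 := Finset.card_sdiff_add_card_inter A B
    have h7 := Finset.card_sdiff_add_card_inter B A
    rw [Finset.inter_comm B A] at h7
    rw [← hA1] at h5
    omega
  have hs1 : hilbN 2 A1 (m + 1) = A1.card :=
    hilbN_of_surj (surj_mono hA1A (evalMap_surj_of_card (hh.trans hr)))
  have hA1r := Finset.card_le_card hA1A
  rw [hd] at hrel
  have hpair := hilbN_pair Z c hcZ m (m + 1) (by
    rwa [show m + (m + 1) = 2 * m + 1 by omega])
  have hm1 := hilbN_mono (m + 1) hA1Z
  rcases le_or_gt A1.card ((m + 2).choose 2) with hle | hgt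
  · have h1 := hilbN_of_surj (surj_of_indep (kruskal_spec 2 m A A1 hA1A (by
      rw [hk]; exact le_min hle (by omega))))
    have h2 := hilbN_mono m hA1Z
    omega
  · obtain ⟨A2, hA2, hc2⟩ := Finset.exists_subset_card_eq hgt.le
    have h1 := hilbN_of_surj (surj_of_indep (kruskal_spec 2 m A A2 (hA2.trans hA1A) (by
      rw [hk]; exact le_min hc2.le (by omega))))
    have h2 := hilbN_mono m (hA2.trans hA1Z)
    exact core m Z c hcZ hrel (by omega) (by omega)
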